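/- Let θ(t) = E(|h| − t)₊² for h ∼ N(0,1) and t ≥ 0. Then (i) θ(t) = (t² + 1)·erfc(t/√2) − sqrt(2/π)·e^{−t²/2}·t, and (ii) θ(t) − (t/2)θ'(t) = erfc(t/√2). -/

import Mathlib

open MeasureTheory ProbabilityTheory
open scoped Real

/-- `θ(t) = E (|h| − t)₊²` for `h ∼ N(0, 1)`. -/
noncomputable def thetaFun (t : ℝ) : ℝ :=
  ∫ x, max (|x| - t) 0 ^ 2 ∂gaussianReal 0 1

/-- The complementary error function `erfc(z) = (2/√π) ∫_z^∞ e^{−u²} du`. -/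
noncomputable def erfc (z : ℝ) : ℝ :=
  (2 / Real.sqrt π) * ∫ u in Set.Ioi z, Real.exp (-u ^ 2)

lemma integrable_exp_neg_sq_half : Integrable fun x : ℝ ↦ Real.exp (-x ^ 2 / 2) := by
  refine (integrable_exp_neg_mul_sq (b := 1 / 2) (by norm_num)).congr (.of_forall fun x ↦ ?_)
  simp only
  congr 1
  ring

lemma integrable_mul_exp_neg_sq_half : Integrable fun x : ℝ ↦ x * Real.exp (-x ^ 2 / 2) := by
  refine (integrable_mul_exp_neg_mul_sq (b := 1 / 2) (by norm_num)).congr (.of_forall fun x ↦ ?_)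
  simp only
  congr 2
  ring

lemma integrable_sq_mul_exp_neg_sq_half :
    Integrable fun x : ℝ ↦ x ^ 2 * Real.exp (-x ^ 2 / 2) := by
  refine (integrable_rpow_mul_exp_neg_mul_sq (b := 1 / 2) (by norm_num) (s := 2)
    (by norm_num)).congr (.of_forall fun x ↦ ?_)
  simp only [Real.rpow_two]
  congr 2
  ring

lemma hasDerivAt_exp_neg_sq_half (x : ℝ) :
    HasDerivAt (fun x : ℝ ↦ Real.exp (-x ^ 2 / 2)) (-x * Real.exp (-x ^ 2 / 2)) x := by
  convert! (((hasDerivAt_id x).pow 2).neg.div_const 2).exp using 1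
  simp
  ring

/-- Integration by parts for the second moment of the Gaussian tail about its endpoint. -/
lemma integral_Ioi_sub_sq_mul_exp_neg_sq_half (t : ℝ) :
    ∫ x in Set.Ioi t, (x - t) ^ 2 * Real.exp (-x ^ 2 / 2) =
      (t ^ 2 + 1) * (∫ x in Set.Ioi t, Real.exp (-x ^ 2 / 2)) - t * Real.exp (-t ^ 2 / 2) := by
  have hderiv : ∀ x ∈ Set.Ici t, HasDerivAt (fun x ↦ (2 * t - x) * Real.exp (-x ^ 2 / 2))
      ((x - t) ^ 2 * Real.exp (-x ^ 2 / 2) - (t ^ 2 + 1) * Real.exp (-x ^ 2 / 2)) x := by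
    intro x _
    convert! ((hasDerivAt_id x).const_sub (2 * t)).mul (hasDerivAt_exp_neg_sq_half x) using 1
    simp
    ring
  have hF : Integrable fun x : ℝ ↦ (2 * t - x) * Real.exp (-x ^ 2 / 2) := by
    convert! (integrable_exp_neg_sq_half.const_mul (2 * t)).sub
      integrable_mul_exp_neg_sq_half using 2 with x
    simp
    ring
  have hG : Integrable fun x : ℝ ↦ (x - t) ^ 2 * Real.exp (-x ^ 2 / 2) := by
    convert! (integrable_sq_mul_exp_neg_sq_half.sub
      (integrable_mul_exp_neg_sq_half.const_mul (2 * t))).add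
      (integrable_exp_neg_sq_half.const_mul (t ^ 2)) using 2 with x
    simp
    ring
  have hE := integrable_exp_neg_sq_half.const_mul (t ^ 2 + 1)
  have hlim := tendsto_zero_of_hasDerivAt_of_integrableOn_Ioi
    (fun x hx ↦ hderiv x (Set.Ioi_subset_Ici_self hx)) (hG.sub hE).integrableOn hF.integrableOn
  have h := integral_Ioi_of_hasDerivAt_of_tendsto' hderiv (hG.sub hE).integrableOn hlim
  rw [integral_sub hG.integrableOn hE.integrableOn, integral_const_mul] at h
  linarith

lemma erfc_div_sqrt_two (t : ℝ) :
    erfc (t / √2) = √(2 / π) * ∫ x in Set.Ioi t, Real.exp (-x ^ 2 / 2) := by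
  have h := integral_comp_mul_left_Ioi (fun u : ℝ ↦ Real.exp (-u ^ 2)) t
    (b := (√2)⁻¹) (by positivity)
  have h2 : ∀ x : ℝ, -((√2)⁻¹ * x) ^ 2 = -x ^ 2 / 2 := fun x ↦ by
    rw [mul_pow, inv_pow, Real.sq_sqrt zero_le_two]
    ring
  simp only [h2, inv_inv, smul_eq_mul] at h
  rw [h, erfc, Real.sqrt_div zero_le_two, div_eq_inv_mul t]
  have := Real.mul_self_sqrt zero_le_two
  linear_combination -(∫ u in Set.Ioi ((√2)⁻¹ * t), Real.exp (-u ^ 2)) / √π * this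

lemma hasDerivAt_erfc_div_sqrt_two (t : ℝ) :
    HasDerivAt (fun t ↦ erfc (t / √2)) (-(√(2 / π) * Real.exp (-t ^ 2 / 2))) t := by
  have hcont : Continuous fun x : ℝ ↦ Real.exp (-x ^ 2 / 2) := by fun_prop
  have h := ((intervalIntegral.integral_hasDerivAt_right (hcont.intervalIntegrable 0 t)
    (hcont.stronglyMeasurableAtFilter _ _) hcont.continuousAt).const_sub
    (∫ x in Set.Ioi (0 : ℝ), Real.exp (-x ^ 2 / 2))).const_mul √(2 / π)
  convert! h using 1
  · ext s
    rw [erfc_div_sqrt_two, ← intervalIntegral.integral_interval_add_Ioi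
      (a := 0) (b := s) integrable_exp_neg_sq_half.integrableOn
      integrable_exp_neg_sq_half.integrableOn]
    ring
  · ring

lemma thetaFun_eq {t : ℝ} (ht : 0 ≤ t) :
    thetaFun t = (t ^ 2 + 1) * erfc (t / √2) - √(2 / π) * Real.exp (-t ^ 2 / 2) * t := by
  have hsub : ∫ x in Set.Ioi (0 : ℝ), max (x - t) 0 ^ 2 * Real.exp (-x ^ 2 / 2) =
      ∫ x in Set.Ioi t, (x - t) ^ 2 * Real.exp (-x ^ 2 / 2) := by
    rw [setIntegral_eq_of_subset_of_forall_sdiff_eq_zero measurableSet_Ioi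
      (Set.Ioi_subset_Ioi ht)]
    · refine setIntegral_congr_fun measurableSet_Ioi fun x hx ↦ ?_
      rw [max_eq_left (sub_nonneg.2 (le_of_lt hx))]
    · intro x hx
      rw [max_eq_right (by simpa using hx.2)]
      simp
  have habs := integral_comp_abs (f := fun x : ℝ ↦ max (x - t) 0 ^ 2 * Real.exp (-x ^ 2 / 2))
  simp only [sq_abs] at habs
  have hc : (√(2 * π))⁻¹ * 2 = √(2 / π) := by
    rw [Real.sqrt_mul zero_le_two, Real.sqrt_div zero_le_two]
    field_simp
    simp
  have hint : thetaFun t =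
      (√(2 * π))⁻¹ * ∫ x, max (|x| - t) 0 ^ 2 * Real.exp (-x ^ 2 / 2) := by
    rw [thetaFun, integral_gaussianReal_eq_integral_smul one_ne_zero, ← integral_const_mul]
    congr 1 with x
    simp [gaussianPDFReal]
    ring
  rw [hint, habs, hsub, integral_Ioi_sub_sq_mul_exp_neg_sq_half, erfc_div_sqrt_two, ← hc]
  ring

lemma hasDerivAt_thetaFun {t : ℝ} (ht : 0 < t) :
    HasDerivAt thetaFun (2 * t * erfc (t / √2) - 2 * √(2 / π) * Real.exp (-t ^ 2 / 2)) t := by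
  have hformula := (((hasDerivAt_id t).pow 2).add_const 1).mul (hasDerivAt_erfc_div_sqrt_two t)
    |>.sub (((hasDerivAt_exp_neg_sq_half t).const_mul √(2 / π)).mul (hasDerivAt_id t))
  refine (hformula.congr_of_eventuallyEq ?_).congr_deriv ?_
  · filter_upwards [lt_mem_nhds ht] with s hs
    simpa using thetaFun_eq hs.le
  · simp
    ring

/-- For `t ≥ 0`:
(i) `θ(t) = (t² + 1) erfc(t/√2) − √(2/π) e^{−t²/2} t`, and
(ii) `θ(t) − (t/2) θ'(t) = erfc(t/√2)`. -/
theorem theta_explicit (t : ℝ) (ht : 0 ≤ t) :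
    thetaFun t =
      (t ^ 2 + 1) * erfc (t / Real.sqrt 2) -
        Real.sqrt (2 / π) * Real.exp (-t ^ 2 / 2) * t ∧
    thetaFun t - (t / 2) * deriv thetaFun t = erfc (t / Real.sqrt 2) := by
  refine ⟨thetaFun_eq ht, ?_⟩
  rw [thetaFun_eq ht]
  rcases ht.eq_or_lt with rfl | ht
  · simp
  · rw [(hasDerivAt_thetaFun ht).deriv]
    ring
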